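/- Let n ≥ 2 and let Φ : ℝⁿ → ℂ be a Schwartz function. There is a constant C > 0, depending only on Φ and n, such that for all s ≥ 1, all orthonormal unit vectors e₁, e₂ ∈ ℝⁿ, and every Schwartz function u : ℝⁿ → ℂ: ∫_{ℝⁿ} |𝓕(Φu)(ξ)|² dξ ≤ C s^{−1} ∫_{ℝⁿ} |p_ζ(ξ)| |𝓕u(ξ)|² dξ. (Equivalently, ‖Φu‖_{L²} ≲ s^{−1/2} ‖u‖_{Ẋ^{1/2}_ζ}.) -/

import Mathlib

open MeasureTheory
open scoped RealInnerProductSpace FourierTransform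

/-- The modulus `|p_ζ(ξ)|` of the symbol `p_ζ(ξ) = -‖ξ‖² + 2iζ·ξ` of the conjugated
Laplacian `Δ + 2ζ·∇`, where `ζ = s(e₁ - i e₂)`. -/
noncomputable def pAbs {n : ℕ} (s : ℝ) (e₁ e₂ ξ : EuclideanSpace ℝ (Fin n)) : ℝ :=
  Real.sqrt ((‖ξ‖ ^ 2 - 2 * s * ⟪e₂, ξ⟫) ^ 2 + 4 * s ^ 2 * ⟪e₁, ξ⟫ ^ 2)

open scoped ENNReal SchwartzMap

/-- A lower integral against a weight that varies slowly along the shifts `y a` is controlled by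
the integral of the averages along these shifts. -/
theorem lintegral_mul_le_lintegral_mul_average {E α : Type*} [AddGroup E] [MeasurableSpace E]
    [MeasurableAdd₂ E] [MeasurableSpace α] (μ : Measure E) [SFinite μ] [μ.IsAddRightInvariant]
    (ν : Measure α) [IsProbabilityMeasure ν] {y : α → E} (hy : Measurable y) {G h : E → ℝ≥0∞}
    (hG : Measurable G) (hh : Measurable h) {K : ℝ≥0∞}
    (hK : ∀ᵐ a ∂ν, ∀ x, G (x + y a) ≤ K * G x) :
    ∫⁻ x, G x * h x ∂μ ≤ K * ∫⁻ x, G x * ∫⁻ a, h (x + y a) ∂ν ∂μ := by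
  have hm : Measurable fun p : E × α => h (p.1 + y p.2) := by fun_prop
  calc ∫⁻ x, G x * h x ∂μ = ∫⁻ _ : α, (∫⁻ x, G x * h x ∂μ) ∂ν := by simp
    _ = ∫⁻ a, (∫⁻ x, G (x + y a) * h (x + y a) ∂μ) ∂ν :=
        lintegral_congr fun a => (lintegral_add_right_eq_self (fun x => G x * h x) (y a)).symm
    _ ≤ ∫⁻ a, (∫⁻ x, K * (G x * h (x + y a)) ∂μ) ∂ν := by
        refine lintegral_mono_ae (hK.mono fun a ha => lintegral_mono fun x => ?_)
        rw [← mul_assoc]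
        gcongr
        exact ha x
    _ = ∫⁻ x, (∫⁻ a, K * (G x * h (x + y a)) ∂ν) ∂μ :=
        lintegral_lintegral_swap (by fun_prop)
    _ = ∫⁻ x, K * (G x * ∫⁻ a, h (x + y a) ∂ν) ∂μ := by
        refine lintegral_congr fun x => ?_
        rw [lintegral_const_mul _ (by fun_prop), lintegral_const_mul _ (by fun_prop)]
    _ = K * ∫⁻ x, G x * ∫⁻ a, h (x + y a) ∂ν ∂μ :=
        lintegral_const_mul _ (hG.mul hm.lintegral_prod_right')

/-- The function `|t|^{-1/2}`, with value `∞` at `0`. -/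
noncomputable def invSqrtAbs (t : ℝ) : ℝ≥0∞ := (ENNReal.ofReal √|t|)⁻¹

@[fun_prop]
theorem measurable_invSqrtAbs : Measurable invSqrtAbs := by
  unfold invSqrtAbs
  fun_prop

theorem invSqrtAbs_neg (t : ℝ) : invSqrtAbs (-t) = invSqrtAbs t := by
  simp [invSqrtAbs]

theorem invSqrtAbs_abs_sub_le (w k : ℝ) :
    invSqrtAbs (|w| - k) ≤ invSqrtAbs (w - k) + invSqrtAbs (w + k) := by
  rcases abs_cases w with ⟨h, -⟩ | ⟨h, -⟩
  · rw [h]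
    exact le_self_add
  · rw [h, ← neg_add', invSqrtAbs_neg]
    exact le_add_self

theorem setLIntegral_invSqrtAbs_Icc_lt_top : ∫⁻ t in Set.Icc (-1) 1, invSqrtAbs t < ∞ := by
  have hpos : ∫⁻ t in Set.Ioc 0 1, invSqrtAbs t < ∞ := by
    have hi : IntegrableOn (fun t : ℝ => t ^ (-(1 / 2) : ℝ)) (Set.Ioc 0 1) :=
      (intervalIntegrable_iff_integrableOn_Ioc_of_le zero_le_one).1
        (intervalIntegral.intervalIntegrable_rpow' (by norm_num))
    have := hi.2
    rw [hasFiniteIntegral_iff_ofReal] at this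
    · refine (setLIntegral_congr_fun measurableSet_Ioc fun t ht => ?_).trans_lt this
      have h0 : 0 < t := ht.1
      simp only [invSqrtAbs]
      rw [abs_of_pos h0, Real.rpow_neg h0.le, ← Real.sqrt_eq_rpow,
        ENNReal.ofReal_inv_of_pos (Real.sqrt_pos.2 h0)]
    · exact (ae_restrict_mem measurableSet_Ioc).mono fun t ht => Real.rpow_nonneg ht.1.le _
  have hneg : ∫⁻ t in Set.Ico (-1) 0, invSqrtAbs t < ∞ := by
    have h := (Measure.measurePreserving_neg (volume : Measure ℝ)).setLIntegral_comp_preimage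
      (s := Set.Ioc 0 1) measurableSet_Ioc measurable_invSqrtAbs
    simp only [invSqrtAbs_neg] at h
    rw [← h] at hpos
    simpa using hpos
  have hsub : Set.Icc (-1 : ℝ) 1 ⊆ (Set.Ico (-1) 0 ∪ {0}) ∪ Set.Ioc 0 1 := by
    intro t ht
    rcases lt_trichotomy t 0 with h | h | h
    · exact Or.inl (Or.inl ⟨ht.1, h⟩)
    · exact Or.inl (Or.inr h)
    · exact Or.inr ⟨h, ht.2⟩
  calc _ ≤ _ := lintegral_mono_set hsub
    _ ≤ _ := lintegral_union_le _ _ _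
    _ ≤ _ := add_le_add_left (lintegral_union_le _ _ _) _
    _ < ∞ := by simp [hpos, hneg]

theorem exists_setLIntegral_invSqrtAbs_add_le :
    ∃ M < ∞, ∀ c : ℝ, ∫⁻ t in Set.Icc 0 1, invSqrtAbs (c + t) ≤ M := by
  refine ⟨1 + ∫⁻ t in Set.Icc (-1) 1, invSqrtAbs t,
    by simp [setLIntegral_invSqrtAbs_Icc_lt_top], fun c => ?_⟩
  set g : ℝ → ℝ≥0∞ := (Set.Icc (-1) 1).indicator invSqrtAbs with hg
  have hle : ∀ t, invSqrtAbs t ≤ 1 + g t := by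
    intro t
    by_cases ht : t ∈ Set.Icc (-1 : ℝ) 1
    · simp [hg, ht]
    · have h1 : 1 ≤ |t| := by
        by_contra h
        exact ht (abs_le.1 (not_le.1 h).le)
      refine le_add_right (ENNReal.inv_le_one.2 ?_)
      simpa using h1
  calc ∫⁻ t in Set.Icc 0 1, invSqrtAbs (c + t)
      ≤ ∫⁻ t in Set.Icc (0 : ℝ) 1, (1 + g (c + t)) := lintegral_mono fun t => hle _
    _ = 1 + ∫⁻ t in Set.Icc (0 : ℝ) 1, g (c + t) := by
        rw [lintegral_add_left measurable_const]
        simp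
    _ ≤ 1 + ∫⁻ t, g (c + t) := by
        gcongr
        exact Measure.restrict_le_self
    _ = 1 + ∫⁻ t, g t := by rw [lintegral_add_left_eq_self]
    _ = _ := by rw [hg, lintegral_indicator measurableSet_Icc]

theorem ENNReal.inv_ofReal_le_of_mul_le {s x p m : ℝ} (hs : 0 < s) (hm : 0 < m)
    (h : s * x ≤ m * p) :
    (ENNReal.ofReal p)⁻¹ ≤
      (ENNReal.ofReal s)⁻¹ * (ENNReal.ofReal m * (ENNReal.ofReal x)⁻¹) := by
  have hs' : ENNReal.ofReal s ≠ 0 := by simpa using hs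
  have hm' : ENNReal.ofReal m ≠ 0 := by simpa using hm
  have h1 : (ENNReal.ofReal m * ENNReal.ofReal p)⁻¹ ≤
      (ENNReal.ofReal s * ENNReal.ofReal x)⁻¹ := by
    rw [← ENNReal.ofReal_mul hm.le, ← ENNReal.ofReal_mul hs.le]
    exact ENNReal.inv_le_inv.2 (ENNReal.ofReal_le_ofReal h)
  rw [ENNReal.mul_inv (.inl hm') (.inl ENNReal.ofReal_ne_top),
    ENNReal.mul_inv (.inl hs') (.inl ENNReal.ofReal_ne_top)] at h1
  calc (ENNReal.ofReal p)⁻¹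
      = ENNReal.ofReal m * ((ENNReal.ofReal m)⁻¹ * (ENNReal.ofReal p)⁻¹) := by
        rw [← mul_assoc, ENNReal.mul_inv_cancel hm' ENNReal.ofReal_ne_top, one_mul]
    _ ≤ ENNReal.ofReal m * ((ENNReal.ofReal s)⁻¹ * (ENNReal.ofReal x)⁻¹) := by gcongr
    _ = _ := by ring

theorem mul_abs_sub_sqrt_le_abs_sq_sub {w K d : ℝ} (hd : d ≤ |w|) :
    d * |(|w| - √K)| ≤ |w ^ 2 - K| := by
  refine (mul_le_mul_of_nonneg_right hd (abs_nonneg _)).trans ?_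
  rcases le_total 0 K with hK | hK
  · have : w ^ 2 - K = (|w| - √K) * (|w| + √K) := by
      linear_combination -(sq_abs w) + Real.sq_sqrt hK
    rw [this, abs_mul, mul_comm, abs_of_nonneg (a := |w| + √K) (by positivity)]
    gcongr
    simp
  · rw [Real.sqrt_eq_zero_of_nonpos hK, sub_zero, abs_abs, abs_mul_abs_self]
    refine le_trans ?_ (le_abs_self _)
    nlinarith

section Symbol

variable {n : ℕ}

local notation "E" => EuclideanSpace ℝ (Fin n)

theorem exists_orthonormalBasis_apply_eq {e : E} (he : ‖e‖ = 1) (i : Fin n) :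
    ∃ b : OrthonormalBasis (Fin n) ℝ E, b i = e := by
  have hv : Orthonormal ℝ (({i} : Set (Fin n)).domRestrict fun _ => e) := by
    refine ⟨fun _ => he, fun x y hxy => (hxy (Subsingleton.elim x y)).elim⟩
  obtain ⟨b, hb⟩ := hv.exists_orthonormalBasis_extension_of_card_eq (by simp)
  exact ⟨b, hb i rfl⟩

/-- The absolute value of the coordinate along `b` at which the sphere of radius `s` about the
origin is met by the line through `y` in direction `b`. -/
noncomputable def sphereHeight (s : ℝ) (b y : E) : ℝ :=
  √(s ^ 2 - (‖y‖ ^ 2 - ⟪b, y⟫ ^ 2))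

theorem sphereHeight_add_smul (s : ℝ) {b : E} (hb : ‖b‖ = 1) (y : E) (t : ℝ) :
    sphereHeight s b (y + t • b) = sphereHeight s b y := by
  unfold sphereHeight
  congr 2
  rw [norm_add_sq_real, inner_add_right, inner_smul_right, inner_smul_right, norm_smul, hb,
    real_inner_self_eq_norm_sq, hb, real_inner_comm, Real.norm_eq_abs, mul_one, sq_abs]
  ring

@[fun_prop]
theorem measurable_sphereHeight (s : ℝ) (b : E) : Measurable (sphereHeight s b) := by
  unfold sphereHeight
  fun_prop

theorem continuous_pAbs (s : ℝ) (e₁ e₂ : E) : Continuous (pAbs s e₁ e₂) := by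
  unfold pAbs
  fun_prop

theorem pAbs_nonneg (s : ℝ) (e₁ e₂ ξ : E) : 0 ≤ pAbs s e₁ e₂ ξ := Real.sqrt_nonneg _

theorem norm_sub_smul_sq_sub_sq (s : ℝ) {e : E} (he : ‖e‖ = 1) (ξ : E) :
    ‖ξ - s • e‖ ^ 2 - s ^ 2 = ‖ξ‖ ^ 2 - 2 * s * ⟪e, ξ⟫ := by
  rw [norm_sub_sq_real, inner_smul_right, norm_smul, he, real_inner_comm, Real.norm_eq_abs,
    mul_one, sq_abs]
  ring

/-- The symbol is large away from its zero set, and near it one of the coordinates orthogonal to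
`e₁` is of size `s`, which makes the sphere transversal to that coordinate direction. -/
theorem le_two_mul_pAbs_or_exists {s : ℝ} (hs : 1 ≤ s) {e₁ e₂ : E} (he₂ : ‖e₂‖ = 1)
    (he : ⟪e₁, e₂⟫ = 0) (b : OrthonormalBasis (Fin n) ℝ E) {i : Fin n} (hi : b i = e₁) (ξ : E) :
    s * 1 ≤ 2 * pAbs s e₁ e₂ ξ ∨ ∃ j ≠ i,
      s * (√|⟪e₁, ξ⟫| * √|(|⟪b j, ξ - s • e₂⟫| - sphereHeight s (b j) (ξ - s • e₂))|) ≤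
        n * pAbs s e₁ e₂ ξ := by
  have hn : (1 : ℝ) ≤ n := by exact_mod_cast i.pos
  set y := ξ - s • e₂ with hy
  set a := ⟪e₁, ξ⟫
  set B := ‖y‖ ^ 2 - s ^ 2 with hB
  have hp : pAbs s e₁ e₂ ξ = √(B ^ 2 + 4 * s ^ 2 * a ^ 2) := by
    rw [pAbs, ← norm_sub_smul_sq_sub_sq s he₂]
  have hay : ⟪b i, y⟫ = a := by
    rw [hi, hy, inner_sub_right, inner_smul_right, he, mul_zero, sub_zero]
  have hsum : ‖y‖ ^ 2 = a ^ 2 + ∑ j ∈ Finset.univ.erase i, ⟪b j, y⟫ ^ 2 := by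
    rw [← b.sum_sq_inner_right y, ← Finset.add_sum_erase _ _ (Finset.mem_univ i), hay]
  rw [hp]
  by_cases hj : ∃ j ≠ i, s / (2 * n) ≤ |⟪b j, y⟫|
  · right
    obtain ⟨j, hji, hj⟩ := hj
    refine ⟨j, hji, ?_⟩
    set D := |(|⟪b j, y⟫| - sphereHeight s (b j) y)| with hD
    have h1 : s / (2 * n) * D ≤ |B| := by
      have := mul_abs_sub_sqrt_le_abs_sq_sub (K := s ^ 2 - (‖y‖ ^ 2 - ⟪b j, y⟫ ^ 2)) hj
      rwa [show ⟪b j, y⟫ ^ 2 - (s ^ 2 - (‖y‖ ^ 2 - ⟪b j, y⟫ ^ 2)) = B by rw [hB]; ring] at this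
    have hD0 : 0 ≤ D := abs_nonneg _
    rw [← Real.sqrt_mul (abs_nonneg _)]
    have h2 : s ^ 2 * (|a| * D) ≤ n ^ 2 * (B ^ 2 + 4 * s ^ 2 * a ^ 2) := by
      have h3 : s * D ≤ 2 * n * |B| := by
        rw [div_mul_eq_mul_div, div_le_iff₀ (by positivity)] at h1
        linarith
      have h4 : s * |a| * (s * D) ≤ s * |a| * (2 * n * |B|) := by gcongr
      have h5 : 4 * (s * |a|) * |B| ≤ B ^ 2 + 4 * s ^ 2 * a ^ 2 := by
        nlinarith [sq_nonneg (2 * (s * |a|) - |B|), sq_abs a, sq_abs B]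
      have h6 : (n : ℝ) ≤ n ^ 2 := by nlinarith
      have h7 : n * (B ^ 2 + 4 * s ^ 2 * a ^ 2) ≤ n ^ 2 * (B ^ 2 + 4 * s ^ 2 * a ^ 2) := by gcongr
      have h8 : n * (4 * (s * |a|) * |B|) ≤ n * (B ^ 2 + 4 * s ^ 2 * a ^ 2) := by gcongr
      have h9 : 0 ≤ n * ((s * |a|) * |B|) := by positivity
      nlinarith
    have h3 := Real.sqrt_le_sqrt h2
    rwa [Real.sqrt_mul (sq_nonneg s), Real.sqrt_mul (sq_nonneg (n : ℝ)),
      Real.sqrt_sq (by positivity), Real.sqrt_sq (by positivity)] at h3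
  · left
    push Not at hj
    have h1 : ∑ j ∈ Finset.univ.erase i, ⟪b j, y⟫ ^ 2 ≤ s ^ 2 / 4 := by
      calc ∑ j ∈ Finset.univ.erase i, ⟪b j, y⟫ ^ 2
          ≤ ∑ j ∈ Finset.univ.erase i, (s / (2 * n)) ^ 2 := by
            refine Finset.sum_le_sum fun j hj' => ?_
            rw [← sq_abs]
            have := hj j (Finset.ne_of_mem_erase hj')
            gcongr
        _ ≤ ∑ j : Fin n, (s / (2 * n)) ^ 2 :=
            Finset.sum_le_sum_of_subset_of_nonneg (Finset.erase_subset _ _)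
              fun _ _ _ => by positivity
        _ = s ^ 2 / 4 * (1 / n) := by
            simp
            field_simp
            norm_num
        _ ≤ s ^ 2 / 4 * 1 := by
            gcongr
            exact (div_le_one (by positivity)).2 hn
        _ = s ^ 2 / 4 := mul_one _
    have h2 : (s / 2) ^ 2 ≤ B ^ 2 + 4 * s ^ 2 * a ^ 2 := by
      rcases le_total (s ^ 2 / 4) (a ^ 2) with h | h
      · have h3 : s ^ 2 * (1 / 4) ≤ s ^ 2 * a ^ 2 := by
          gcongr
          nlinarith
        nlinarith [sq_nonneg B, sq_nonneg s]
      · have h3 : s ^ 2 / 2 ≤ -B := by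
          rw [hB, hsum]
          linarith
        have h4 : s / 2 ≤ -B := by nlinarith
        nlinarith [mul_nonneg (sq_nonneg s) (sq_nonneg a)]
    have := Real.le_sqrt_of_sq_le h2
    linarith

/-- The majorant of the reciprocal symbol near the part of its zero set that is transversal to
the direction `b`. -/
noncomputable def transversalBound (s : ℝ) (e₁ e₂ b ξ : E) : ℝ≥0∞ :=
  invSqrtAbs ⟪e₁, ξ⟫ * invSqrtAbs (|⟪b, ξ - s • e₂⟫| - sphereHeight s b (ξ - s • e₂))

theorem measurable_transversalBound (s : ℝ) (e₁ e₂ b : E) :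
    Measurable (transversalBound s e₁ e₂ b) := by
  unfold transversalBound
  fun_prop

theorem inv_pAbs_le {s : ℝ} (hs : 1 ≤ s) {e₁ e₂ : E} (he₂ : ‖e₂‖ = 1)
    (he : ⟪e₁, e₂⟫ = 0) (b : OrthonormalBasis (Fin n) ℝ E) {i : Fin n} (hi : b i = e₁) (ξ : E) :
    (ENNReal.ofReal (pAbs s e₁ e₂ ξ))⁻¹ ≤ (ENNReal.ofReal s)⁻¹ *
      (2 + n * ∑ j ∈ Finset.univ.erase i, transversalBound s e₁ e₂ (b j) ξ) := by
  have hs0 : 0 < s := by linarith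
  rcases le_two_mul_pAbs_or_exists hs he₂ he b hi ξ with h | ⟨j, hji, h⟩
  · refine (ENNReal.inv_ofReal_le_of_mul_le hs0 two_pos h).trans ?_
    gcongr
    simp
  · refine (ENNReal.inv_ofReal_le_of_mul_le hs0 (by exact_mod_cast i.pos) h).trans ?_
    gcongr
    refine le_add_left ?_
    rw [ENNReal.ofReal_natCast]
    gcongr
    refine le_trans (le_of_eq ?_) (Finset.single_le_sum
      (f := fun j => transversalBound s e₁ e₂ (b j) ξ) (fun _ _ => zero_le)
      (Finset.mem_erase.2 ⟨hji, Finset.mem_univ j⟩))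
    rw [ENNReal.ofReal_mul (by positivity), ENNReal.mul_inv (by simp) (by simp)]
    rfl

theorem lintegral_mul_transversalBound_le {M : ℝ≥0∞}
    (hM : ∀ c : ℝ, ∫⁻ t in Set.Icc 0 1, invSqrtAbs (c + t) ≤ M) {G : E → ℝ≥0∞}
    (hG : Measurable G) {K : ℝ≥0∞} (hK : ∀ x y, ‖y‖ ≤ 1 → G (x + y) ≤ K * G x) (s : ℝ)
    {e₁ e₂ b : E} (he₁ : ‖e₁‖ = 1) (hb : ‖b‖ = 1) (hbe : ⟪e₁, b⟫ = 0) :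
    ∫⁻ x, G x * transversalBound s e₁ e₂ b x ≤ 2 * (K * M) ^ 2 * ∫⁻ x, G x := by
  have : IsProbabilityMeasure (volume.restrict (Set.Icc (0 : ℝ) 1)) := ⟨by simp⟩
  have hshift : ∀ e : E, ‖e‖ = 1 → ∀ᵐ t ∂volume.restrict (Set.Icc (0 : ℝ) 1), ∀ x,
      G (x + t • e) ≤ K * G x := fun e he =>
    (ae_restrict_mem measurableSet_Icc).mono fun t ht x => hK _ _ (by
      rw [norm_smul, he, mul_one, Real.norm_eq_abs, abs_of_nonneg ht.1]
      exact ht.2)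
  have hinner : ∀ x, ∫⁻ t in Set.Icc (0 : ℝ) 1, transversalBound s e₁ e₂ b (x + t • b) ≤
      invSqrtAbs ⟪e₁, x⟫ * (2 * M) := by
    intro x
    set w := ⟪b, x - s • e₂⟫ with hw
    set k := sphereHeight s b (x - s • e₂) with hk
    have heq : ∀ t : ℝ, transversalBound s e₁ e₂ b (x + t • b) =
        invSqrtAbs ⟪e₁, x⟫ * invSqrtAbs (|w + t| - k) := by
      intro t
      rw [transversalBound, add_sub_right_comm, sphereHeight_add_smul s hb, inner_add_right,
        inner_add_right, inner_smul_right, inner_smul_right, hbe, real_inner_self_eq_norm_sq, hb]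
      simp [hw, hk]
    simp_rw [heq]
    rw [lintegral_const_mul _ (by fun_prop)]
    gcongr
    calc ∫⁻ t in Set.Icc (0 : ℝ) 1, invSqrtAbs (|w + t| - k)
        ≤ ∫⁻ t in Set.Icc (0 : ℝ) 1, (invSqrtAbs ((w - k) + t) + invSqrtAbs ((w + k) + t)) := by
          refine lintegral_mono fun t => (invSqrtAbs_abs_sub_le _ _).trans (le_of_eq ?_)
          congr 2 <;> ring
      _ ≤ M + M := by
          rw [lintegral_add_left (by fun_prop)]
          exact add_le_add (hM _) (hM _)
      _ = 2 * M := (two_mul M).symm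
  have houter : ∀ x, ∫⁻ t in Set.Icc (0 : ℝ) 1, invSqrtAbs ⟪e₁, x + t • e₁⟫ ≤ M := by
    intro x
    refine le_trans (le_of_eq (lintegral_congr fun t => ?_)) (hM ⟪e₁, x⟫)
    rw [inner_add_right, inner_smul_right, real_inner_self_eq_norm_sq, he₁]
    simp
  calc ∫⁻ x, G x * transversalBound s e₁ e₂ b x
      ≤ K * ∫⁻ x, G x * ∫⁻ t in Set.Icc (0 : ℝ) 1, transversalBound s e₁ e₂ b (x + t • b) :=
        lintegral_mul_le_lintegral_mul_average volume _ (by fun_prop) hG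
          (measurable_transversalBound s e₁ e₂ b) (hshift b hb)
    _ ≤ K * ∫⁻ x, (2 * M) * (G x * invSqrtAbs ⟪e₁, x⟫) := by
        refine mul_le_mul_right (lintegral_mono fun x => ?_) K
        calc G x * ∫⁻ t in Set.Icc (0 : ℝ) 1, transversalBound s e₁ e₂ b (x + t • b)
            ≤ G x * (invSqrtAbs ⟪e₁, x⟫ * (2 * M)) := by
              gcongr
              exact hinner x
          _ = _ := by ring
    _ = 2 * K * M * ∫⁻ x, G x * invSqrtAbs ⟪e₁, x⟫ := by
        rw [lintegral_const_mul _ (by fun_prop)]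
        ring
    _ ≤ 2 * K * M *
          (K * ∫⁻ x, G x * ∫⁻ t in Set.Icc (0 : ℝ) 1, invSqrtAbs ⟪e₁, x + t • e₁⟫) := by
        gcongr
        exact lintegral_mul_le_lintegral_mul_average volume _ (by fun_prop) hG
          (h := fun x => invSqrtAbs ⟪e₁, x⟫) (by fun_prop) (hshift e₁ he₁)
    _ ≤ 2 * K * M * (K * ∫⁻ x, G x * M) := by
        gcongr with x
        exact houter x
    _ = 2 * (K * M) ^ 2 * ∫⁻ x, G x := by
        rw [lintegral_mul_const _ hG]
        ring

/-- Weighted integrals of the reciprocal symbol are `O(s⁻¹)`, uniformly in the frame. -/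
theorem lintegral_mul_inv_pAbs_le {M : ℝ≥0∞}
    (hM : ∀ c : ℝ, ∫⁻ t in Set.Icc 0 1, invSqrtAbs (c + t) ≤ M) {G : E → ℝ≥0∞}
    (hG : Measurable G) {K : ℝ≥0∞} (hK : ∀ x y, ‖y‖ ≤ 1 → G (x + y) ≤ K * G x)
    (hn : 0 < n) {s : ℝ} (hs : 1 ≤ s)
    {e₁ e₂ : E} (he₁ : ‖e₁‖ = 1) (he₂ : ‖e₂‖ = 1) (he : ⟪e₁, e₂⟫ = 0) :
    ∫⁻ x, G x * (ENNReal.ofReal (pAbs s e₁ e₂ x))⁻¹ ≤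
      (ENNReal.ofReal s)⁻¹ * ((2 + n * (n * (2 * (K * M) ^ 2))) * ∫⁻ x, G x) := by
  obtain ⟨b, hb⟩ := exists_orthonormalBasis_apply_eq he₁ ⟨0, hn⟩
  set i : Fin n := ⟨0, hn⟩
  have hm := fun j => measurable_transversalBound s e₁ e₂ (b j)
  calc ∫⁻ x, G x * (ENNReal.ofReal (pAbs s e₁ e₂ x))⁻¹
      ≤ ∫⁻ x, (ENNReal.ofReal s)⁻¹ * (2 * G x +
          n * ∑ j ∈ Finset.univ.erase i, G x * transversalBound s e₁ e₂ (b j) x) := by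
        refine lintegral_mono fun x => ?_
        calc G x * (ENNReal.ofReal (pAbs s e₁ e₂ x))⁻¹
            ≤ G x * ((ENNReal.ofReal s)⁻¹ *
                (2 + n * ∑ j ∈ Finset.univ.erase i, transversalBound s e₁ e₂ (b j) x)) := by
              gcongr
              exact inv_pAbs_le hs he₂ he b hb x
          _ = _ := by
              rw [← Finset.mul_sum]
              ring
    _ = (ENNReal.ofReal s)⁻¹ * (2 * (∫⁻ x, G x) +
          n * ∑ j ∈ Finset.univ.erase i, ∫⁻ x, G x * transversalBound s e₁ e₂ (b j) x) := by
        rw [lintegral_const_mul _ (by fun_prop), lintegral_add_left (by fun_prop),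
          lintegral_const_mul _ hG, lintegral_const_mul _ (by fun_prop),
          lintegral_finsetSum _ fun j _ => by fun_prop]
    _ ≤ (ENNReal.ofReal s)⁻¹ * (2 * (∫⁻ x, G x) +
          n * ∑ j : Fin n, (2 * (K * M) ^ 2 * ∫⁻ x, G x)) := by
        gcongr
        refine (Finset.sum_le_sum fun j hj => ?_).trans
          (Finset.sum_le_sum_of_subset (Finset.erase_subset _ _))
        refine lintegral_mul_transversalBound_le hM hG hK s he₁ (b.orthonormal.1 j) ?_
        rw [← hb]
        exact b.orthonormal.2 (Finset.ne_of_mem_erase hj).symm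
    _ = _ := by
        simp
        ring

end Symbol

/-- Cauchy–Schwarz against a positive weight `G`, split by a factor `P`. -/
theorem ENNReal.sq_lintegral_mul_le {α : Type*} [MeasurableSpace α] {μ : Measure α}
    {G P v : α → ℝ≥0∞} (hG : Measurable G) (hP : Measurable P) (hv : Measurable v)
    (hG0 : ∀ x, G x ≠ 0) (hPtop : ∀ x, P x ≠ ∞) (hfin : ∫⁻ x, G x * (P x)⁻¹ ∂μ ≠ ∞) :
    (∫⁻ x, G x * v x ∂μ) ^ 2 ≤ (∫⁻ x, G x * (P x)⁻¹ ∂μ) * ∫⁻ x, G x * (P x * v x ^ 2) ∂μ := by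
  have hsq : ∀ t : ℝ≥0∞, (t ^ (1 / 2 : ℝ)) ^ (2 : ℝ) = t := fun t => by
    rw [← ENNReal.rpow_mul]
    norm_num
  have hae : ∀ᵐ x ∂μ, G x * v x =
      (G x * (P x)⁻¹) ^ (1 / 2 : ℝ) * (G x * (P x * v x ^ 2)) ^ (1 / 2 : ℝ) := by
    filter_upwards [ae_lt_top (by fun_prop) hfin] with x hx
    have hP0 : P x ≠ 0 := by
      intro h
      simp [h, ENNReal.mul_top (hG0 x)] at hx
    rw [← ENNReal.mul_rpow_of_nonneg _ _ (by norm_num)]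
    calc G x * v x = ((G x * v x) ^ (2 : ℝ)) ^ (1 / 2 : ℝ) := by
          rw [← ENNReal.rpow_mul]
          norm_num
      _ = _ := by
          congr 1
          rw [ENNReal.rpow_two]
          calc (G x * v x) ^ 2 = G x ^ 2 * v x ^ 2 * (P x * (P x)⁻¹) := by
                rw [ENNReal.mul_inv_cancel hP0 (hPtop x)]
                ring
            _ = _ := by ring
  have h := ENNReal.lintegral_mul_le_Lp_mul_Lq μ Real.HolderConjugate.two_two
    (f := fun x => (G x * (P x)⁻¹) ^ (1 / 2 : ℝ))
    (g := fun x => (G x * (P x * v x ^ 2)) ^ (1 / 2 : ℝ)) (by fun_prop) (by fun_prop)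
  simp only [Pi.mul_apply, hsq] at h
  rw [lintegral_congr_ae hae]
  calc _ ≤ _ := pow_le_pow_left' h 2
    _ = _ := by
        rw [mul_pow, ← ENNReal.rpow_two, ← ENNReal.rpow_two, hsq, hsq]

/-- The Fourier transform of a product of Schwartz functions is the convolution of their Fourier
transforms. -/
theorem SchwartzMap.fourier_mul_apply {V : Type*} [NormedAddCommGroup V] [InnerProductSpace ℝ V]
    [FiniteDimensional ℝ V] [MeasurableSpace V] [BorelSpace V] (f g : 𝓢(V, ℂ)) (ξ : V) :
    𝓕 (fun x => f x * g x) ξ = ∫ η, 𝓕 f (ξ - η) * 𝓕 g η := by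
  have hneg : ∀ (h : 𝓢(V, ℂ)) (x : V), 𝓕 (𝓕 h) x = h (-x) := by
    intro h x
    have h1 : 𝓕⁻ (𝓕 h) (-x) = h (-x) := by rw [FourierTransform.fourierInv_fourier_eq]
    rw [← h1, SchwartzMap.fourierInv_coe, Real.fourierInv_eq_fourier_neg, neg_neg]
    rfl
  have h := SchwartzMap.convolution_apply (ContinuousLinearMap.mul ℂ ℂ) (𝓕 g) (𝓕 f) ξ
  rw [convolution_def] at h
  simp only [ContinuousLinearMap.mul_apply'] at h
  simp_rw [mul_comm (𝓕 f _)]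
  rw [← h]
  change _ = 𝓕⁻ (SchwartzMap.pairing (ContinuousLinearMap.mul ℂ ℂ) (𝓕 (𝓕 g)) (𝓕 (𝓕 f))) ξ
  rw [SchwartzMap.fourierInv_coe, Real.fourierInv_eq_fourier_comp_neg]
  refine congrFun (congrArg 𝓕 (funext fun x => ?_)) ξ
  simp [SchwartzMap.pairing_apply_apply, hneg, mul_comm]

theorem SchwartzMap.exists_norm_le_mul_one_add_norm_rpow {V : Type*} [NormedAddCommGroup V]
    [NormedSpace ℝ V] (f : 𝓢(V, ℂ)) (k : ℕ) :
    ∃ C : ℝ, 0 ≤ C ∧ ∀ x, ‖f x‖ ≤ C * (1 + ‖x‖) ^ (-(k : ℝ)) := by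
  refine ⟨2 ^ k * (Finset.Iic (k, 0)).sup (fun m => SchwartzMap.seminorm ℝ m.1 m.2) f,
    by positivity, fun x => ?_⟩
  have h := SchwartzMap.one_add_le_sup_seminorm_apply (𝕜 := ℝ) (m := (k, 0)) le_rfl le_rfl f x
  rw [norm_iteratedFDeriv_zero] at h
  have h0 : 0 < 1 + ‖x‖ := by positivity
  rw [Real.rpow_neg h0.le, Real.rpow_natCast, ← div_eq_mul_inv, le_div_iff₀ (by positivity)]
  linarith

theorem one_add_norm_rpow_neg_add_le {V : Type*} [SeminormedAddCommGroup V] {r : ℝ} (hr : 0 ≤ r)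
    (x : V) {y : V} (hy : ‖y‖ ≤ 1) :
    (1 + ‖x + y‖) ^ (-r) ≤ 2 ^ r * (1 + ‖x‖) ^ (-r) := by
  have hx : 0 ≤ 1 + ‖x‖ := by positivity
  have hxy : 0 < 1 + ‖x + y‖ := by positivity
  have h : (1 + ‖x‖) / 2 ≤ 1 + ‖x + y‖ := by
    have := norm_sub_le (x + y) y
    rw [add_sub_cancel_right] at this
    linarith [norm_nonneg (x + y)]
  calc (1 + ‖x + y‖) ^ (-r) ≤ ((1 + ‖x‖) / 2) ^ (-r) :=
        Real.rpow_le_rpow_of_nonpos (by positivity) h (by linarith)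
    _ = 2 ^ r * (1 + ‖x‖) ^ (-r) := by
        rw [Real.div_rpow hx two_pos.le, Real.rpow_neg two_pos.le, div_inv_eq_mul, mul_comm]

theorem integrable_pAbs_mul_norm_sq {n : ℕ} (s : ℝ) (e₁ e₂ : EuclideanSpace ℝ (Fin n))
    (v : 𝓢(EuclideanSpace ℝ (Fin n), ℂ)) :
    Integrable fun ξ => pAbs s e₁ e₂ ξ * ‖v ξ‖ ^ 2 := by
  obtain ⟨C, hC0, hC⟩ := v.exists_norm_le_mul_one_add_norm_rpow 0
  simp only [Nat.cast_zero, neg_zero, Real.rpow_zero, mul_one] at hC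
  have hp : ∀ ξ, pAbs s e₁ e₂ ξ ≤
      ‖ξ‖ ^ 2 + (2 * |s| * ‖e₂‖ + 2 * |s| * ‖e₁‖) * ‖ξ‖ := by
    intro ξ
    have h1 := abs_real_inner_le_norm e₁ ξ
    have h2 := abs_real_inner_le_norm e₂ ξ
    have h3 : |‖ξ‖ ^ 2 - 2 * s * ⟪e₂, ξ⟫| ≤ ‖ξ‖ ^ 2 + 2 * |s| * (‖e₂‖ * ‖ξ‖) := by
      refine (abs_sub _ _).trans ?_
      rw [abs_of_nonneg (sq_nonneg _), abs_mul, abs_mul, abs_two]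
      gcongr
    have h4 : |2 * s * ⟪e₁, ξ⟫| ≤ 2 * |s| * (‖e₁‖ * ‖ξ‖) := by
      rw [abs_mul, abs_mul, abs_two]
      gcongr
    calc pAbs s e₁ e₂ ξ
        ≤ |‖ξ‖ ^ 2 - 2 * s * ⟪e₂, ξ⟫| + |2 * s * ⟪e₁, ξ⟫| := by
          refine Real.sqrt_le_iff.2 ⟨by positivity, ?_⟩
          nlinarith [sq_abs (‖ξ‖ ^ 2 - 2 * s * ⟪e₂, ξ⟫), sq_abs (2 * s * ⟪e₁, ξ⟫),
            mul_nonneg (abs_nonneg (‖ξ‖ ^ 2 - 2 * s * ⟪e₂, ξ⟫)) (abs_nonneg (2 * s * ⟪e₁, ξ⟫))]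
      _ ≤ _ := by linarith
  have hint := ((v.integrable_pow_mul volume 2).add
    ((v.integrable_pow_mul volume 1).const_mul
      (2 * |s| * ‖e₂‖ + 2 * |s| * ‖e₁‖))).mul_const C
  refine hint.mono' ?_ (Filter.Eventually.of_forall fun ξ => ?_)
  · have := continuous_pAbs s e₁ e₂
    have := v.continuous
    exact Continuous.aestronglyMeasurable (by fun_prop)
  · have hp0 := pAbs_nonneg s e₁ e₂ ξ
    rw [Real.norm_of_nonneg (by positivity)]
    calc pAbs s e₁ e₂ ξ * ‖v ξ‖ ^ 2 = pAbs s e₁ e₂ ξ * ‖v ξ‖ * ‖v ξ‖ := by ring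
      _ ≤ (‖ξ‖ ^ 2 + (2 * |s| * ‖e₂‖ + 2 * |s| * ‖e₁‖) * ‖ξ‖) * ‖v ξ‖ * C := by
        have := hp ξ
        have := hC ξ
        gcongr
      _ = _ := by
        simp only [Pi.add_apply, pow_one]
        ring

/-- `L²` bound for convolution with a function dominated by an integrable weight `G`. -/
theorem lintegral_sq_convolution_le {V : Type*} [AddCommGroup V] [MeasurableSpace V]
    [MeasurableAdd₂ V] [MeasurableNeg V] {μ : Measure V} [SFinite μ] [μ.IsAddLeftInvariant]
    [μ.IsNegInvariant] {G P v : V → ℝ≥0∞} (hG : Measurable G) (hP : Measurable P)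
    (hv : Measurable v) (hG0 : ∀ x, G x ≠ 0) (hPtop : ∀ x, P x ≠ ∞) {B : ℝ≥0∞} (hB : B ≠ ∞)
    (hGP : ∀ ξ, ∫⁻ η, G (ξ - η) * (P η)⁻¹ ∂μ ≤ B) :
    ∫⁻ ξ, (∫⁻ η, G (ξ - η) * v η ∂μ) ^ 2 ∂μ ≤
      B * ((∫⁻ x, G x ∂μ) * ∫⁻ η, P η * v η ^ 2 ∂μ) := by
  calc ∫⁻ ξ, (∫⁻ η, G (ξ - η) * v η ∂μ) ^ 2 ∂μ
      ≤ ∫⁻ ξ, B * ∫⁻ η, G (ξ - η) * (P η * v η ^ 2) ∂μ ∂μ := by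
        refine lintegral_mono fun ξ => ?_
        refine (ENNReal.sq_lintegral_mul_le (by fun_prop) hP hv (fun _ => hG0 _) hPtop
          (ne_top_of_le_ne_top hB (hGP ξ))).trans ?_
        gcongr
        exact hGP ξ
    _ = B * ∫⁻ ξ, ∫⁻ η, G (ξ - η) * (P η * v η ^ 2) ∂μ ∂μ :=
        lintegral_const_mul _ (Measurable.lintegral_prod_right'
          (f := fun p : V × V => G (p.1 - p.2) * (P p.2 * v p.2 ^ 2)) (by fun_prop))
    _ = B * ∫⁻ η, ∫⁻ ξ, G (ξ - η) * (P η * v η ^ 2) ∂μ ∂μ := by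
        rw [lintegral_lintegral_swap (by fun_prop)]
    _ = B * ∫⁻ η, (∫⁻ x, G x ∂μ) * (P η * v η ^ 2) ∂μ := by
        congr 1
        refine lintegral_congr fun η => ?_
        rw [lintegral_mul_const _ (by fun_prop), lintegral_sub_right_eq_self]
    _ = _ := by rw [lintegral_const_mul _ (by fun_prop)]

theorem exists_lintegral_fourier_mul_le {n : ℕ} (hn : 0 < n)
    (Φ : 𝓢(EuclideanSpace ℝ (Fin n), ℂ)) :
    ∃ C : ℝ≥0∞, C ≠ ∞ ∧ ∀ s ≥ (1 : ℝ), ∀ e₁ e₂ : EuclideanSpace ℝ (Fin n),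
      ‖e₁‖ = 1 → ‖e₂‖ = 1 → ⟪e₁, e₂⟫ = 0 → ∀ u : 𝓢(EuclideanSpace ℝ (Fin n), ℂ),
        ∫⁻ ξ, ‖𝓕 (fun x => Φ x * u x) ξ‖ₑ ^ 2 ≤
          C * (ENNReal.ofReal s)⁻¹ * ∫⁻ ξ, ENNReal.ofReal (pAbs s e₁ e₂ ξ) * ‖𝓕 u ξ‖ₑ ^ 2 := by
  obtain ⟨M, hMtop, hM⟩ := exists_setLIntegral_invSqrtAbs_add_le
  obtain ⟨D, hD0, hD⟩ := (𝓕 Φ).exists_norm_le_mul_one_add_norm_rpow (n + 1)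
  set r : ℝ := ((n + 1 : ℕ) : ℝ) with hr
  have hr0 : 0 ≤ r := by positivity
  set G : EuclideanSpace ℝ (Fin n) → ℝ≥0∞ := fun x => ENNReal.ofReal ((1 + ‖x‖) ^ (-r)) with hGdef
  have hG : Measurable G := by fun_prop
  have hG0 : ∀ x, G x ≠ 0 := fun x => by
    have : 0 < (1 + ‖x‖) ^ (-r) := by positivity
    simpa [hGdef] using this
  set A := ∫⁻ x, G x
  have hAtop : A ≠ ∞ := (finite_integral_one_add_norm (by simp [hr])).ne
  set K : ℝ≥0∞ := ENNReal.ofReal (2 ^ r)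
  have hK : ∀ x y, ‖y‖ ≤ 1 → G (x + y) ≤ K * G x := fun x y hy => by
    rw [hGdef, ← ENNReal.ofReal_mul (by positivity)]
    exact ENNReal.ofReal_le_ofReal (one_add_norm_rpow_neg_add_le hr0 x hy)
  have hΦ : ∀ x, ‖𝓕 Φ x‖ₑ ≤ ENNReal.ofReal D * G x := fun x => by
    rw [hGdef, ← ENNReal.ofReal_mul hD0, ← ofReal_norm]
    exact ENNReal.ofReal_le_ofReal (hD x)
  set L : ℝ≥0∞ := (2 + n * (n * (2 * (K * M) ^ 2))) * A
  have hLtop : L ≠ ∞ := by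
    have := hMtop.ne
    finiteness
  refine ⟨ENNReal.ofReal D ^ 2 * (L * A), by finiteness, fun s hs e₁ e₂ he₁ he₂ he u => ?_⟩
  have hs' : (ENNReal.ofReal s)⁻¹ ≠ ∞ := by
    simpa using zero_lt_one.trans_le hs
  have hGP : ∀ ξ, ∫⁻ η, G (ξ - η) * (ENNReal.ofReal (pAbs s e₁ e₂ η))⁻¹ ≤
      (ENNReal.ofReal s)⁻¹ * L := fun ξ => by
    have h := lintegral_mul_inv_pAbs_le hM (G := fun η => G (ξ - η)) (by fun_prop) (K := K)
      (fun x y hy => by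
        rw [← sub_sub, sub_eq_add_neg _ y]
        exact hK _ _ (by rwa [norm_neg])) hn hs he₁ he₂ he
    rwa [lintegral_sub_left_eq_self] at h
  have hP : Measurable fun ξ => ENNReal.ofReal (pAbs s e₁ e₂ ξ) :=
    (continuous_pAbs s e₁ e₂).measurable.ennreal_ofReal
  have hv : Measurable fun ξ => ‖𝓕 u ξ‖ₑ := (𝓕 u).continuous.measurable.enorm
  calc ∫⁻ ξ, ‖𝓕 (fun x => Φ x * u x) ξ‖ₑ ^ 2
      ≤ ∫⁻ ξ, ENNReal.ofReal D ^ 2 * (∫⁻ η, G (ξ - η) * ‖𝓕 u η‖ₑ) ^ 2 := by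
        refine lintegral_mono fun ξ => ?_
        rw [← mul_pow, SchwartzMap.fourier_mul_apply]
        gcongr
        refine (enorm_integral_le_lintegral_enorm _).trans ?_
        rw [← lintegral_const_mul _ (by fun_prop)]
        refine lintegral_mono fun η => ?_
        rw [enorm_mul, ← mul_assoc]
        gcongr
        exact hΦ _
    _ = ENNReal.ofReal D ^ 2 * ∫⁻ ξ, (∫⁻ η, G (ξ - η) * ‖𝓕 u η‖ₑ) ^ 2 :=
        lintegral_const_mul' _ _ (by finiteness)
    _ ≤ ENNReal.ofReal D ^ 2 * ((ENNReal.ofReal s)⁻¹ * L *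
          (A * ∫⁻ ξ, ENNReal.ofReal (pAbs s e₁ e₂ ξ) * ‖𝓕 u ξ‖ₑ ^ 2)) := by
        gcongr
        exact lintegral_sq_convolution_le hG hP hv hG0 (fun _ => ENNReal.ofReal_ne_top)
          (ENNReal.mul_ne_top hs' hLtop) hGP
    _ = _ := by ring

/-- `‖Φu‖_{L²} ≲ s^{-1/2} ‖u‖_{Ẋ^{1/2}_ζ}` uniformly over `s ≥ 1` and
orthonormal `e₁, e₂`, for a fixed Schwartz cutoff `Φ`. -/
theorem stmt_14 (n : ℕ) (hn : 2 ≤ n)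
    (Φ : SchwartzMap (EuclideanSpace ℝ (Fin n)) ℂ) :
    ∃ C > 0, ∀ s ≥ (1 : ℝ), ∀ e₁ e₂ : EuclideanSpace ℝ (Fin n),
      ‖e₁‖ = 1 → ‖e₂‖ = 1 → ⟪e₁, e₂⟫ = 0 →
      ∀ u : SchwartzMap (EuclideanSpace ℝ (Fin n)) ℂ,
        ∫ ξ, ‖𝓕 (fun x => Φ x * u x) ξ‖ ^ 2 ≤ C * s⁻¹ * ∫ ξ, pAbs s e₁ e₂ ξ * ‖𝓕 (⇑u) ξ‖ ^ 2 := by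
  obtain ⟨C, hC, h⟩ := exists_lintegral_fourier_mul_le (by omega : 0 < n) Φ
  refine ⟨C.toReal + 1, by positivity, fun s hs e₁ e₂ he₁ he₂ he u => ?_⟩
  have hs0 : 0 < s := by linarith
  have hR : ∫⁻ ξ, ENNReal.ofReal (pAbs s e₁ e₂ ξ) * ‖𝓕 u ξ‖ₑ ^ 2 =
      ENNReal.ofReal (∫ ξ, pAbs s e₁ e₂ ξ * ‖𝓕 (⇑u) ξ‖ ^ 2) := by
    rw [← SchwartzMap.fourier_coe,
      ofReal_integral_eq_lintegral_ofReal (integrable_pAbs_mul_norm_sq s e₁ e₂ (𝓕 u))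
      (Filter.Eventually.of_forall fun ξ => mul_nonneg (pAbs_nonneg s e₁ e₂ ξ) (sq_nonneg _))]
    refine lintegral_congr fun ξ => ?_
    rw [ENNReal.ofReal_mul (pAbs_nonneg s e₁ e₂ ξ), ENNReal.ofReal_pow (norm_nonneg _),
      ofReal_norm]
  have hI : 0 ≤ ∫ ξ, pAbs s e₁ e₂ ξ * ‖𝓕 (⇑u) ξ‖ ^ 2 :=
    integral_nonneg fun ξ => mul_nonneg (pAbs_nonneg s e₁ e₂ ξ) (sq_nonneg _)
  have hle : ∫⁻ ξ, ENNReal.ofReal (‖𝓕 (fun x => Φ x * u x) ξ‖ ^ 2) ≤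
      ENNReal.ofReal (C.toReal * s⁻¹ * ∫ ξ, pAbs s e₁ e₂ ξ * ‖𝓕 (⇑u) ξ‖ ^ 2) := by
    have h' := h s hs e₁ e₂ he₁ he₂ he u
    rw [hR] at h'
    rw [ENNReal.ofReal_mul (by positivity), ENNReal.ofReal_mul (by positivity),
      ENNReal.ofReal_toReal hC, ENNReal.ofReal_inv_of_pos hs0]
    refine le_trans (le_of_eq (lintegral_congr fun ξ => ?_)) h'
    rw [ENNReal.ofReal_pow (norm_nonneg _), ofReal_norm]
  calc ∫ ξ, ‖𝓕 (fun x => Φ x * u x) ξ‖ ^ 2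
      ≤ ENNReal.toReal (∫⁻ ξ, ENNReal.ofReal ‖‖𝓕 (fun x => Φ x * u x) ξ‖ ^ 2‖) :=
        (Real.le_norm_self _).trans (norm_integral_le_lintegral_norm _)
    _ ≤ C.toReal * s⁻¹ * ∫ ξ, pAbs s e₁ e₂ ξ * ‖𝓕 (⇑u) ξ‖ ^ 2 := by
        refine ENNReal.toReal_le_of_le_ofReal (by positivity) ?_
        simpa only [norm_pow, norm_norm] using hle
    _ ≤ (C.toReal + 1) * s⁻¹ * ∫ ξ, pAbs s e₁ e₂ ξ * ‖𝓕 (⇑u) ξ‖ ^ 2 := by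
        gcongr
        linarith
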